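/- arXiv:1207.6503 — 4 statements merged into one kernel-verified Lean document; each statement's English description precedes it below -/
import Mathlib

section
/- Suppose the families U(2^m), V(2^m), F(2^m) satisfy conditions (1)–(8) at every index m ≥ 1. Let α ≥ 1 be a natural number with binary expansion α = 2^{p_1} + ⋯ + 2^{p_t}, and suppose p_i ∉ S for all i = 1, …, t. Then dim_K V^>(α) ≤ 2α. -/
/-
Formalization of statements from:
"Golod-Shafarevich algebras of a reduced number of defining relations" (A. Smoktunowicz).

`FA K` is the free associative unital `K`-algebra `A = K⟨x,y⟩` on two generators
(`FreeAlgebra.ι K 0` and `FreeAlgebra.ι K 1`), graded with the generators in degree 1.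
-/

open scoped Pointwise Classical

noncomputable section

/-- The free associative unital `K`-algebra on two generators. -/
abbrev FA (K : Type) [Field K] : Type := FreeAlgebra K (Fin 2)

variable (K : Type) [Field K]

/-- The set of monomials of degree `k` in the free algebra on two generators. -/
def Mon (k : ℕ) : Set (FA K) :=
  { m | ∃ w : List (Fin 2), w.length = k ∧ m = (w.map (FreeAlgebra.ι K)).prod }

/-- `Adeg K k` is the `k`-th homogeneous component `A(k)`: the span of the monomials of
degree `k`. -/
def Adeg (k : ℕ) : Submodule K (FA K) :=
  Submodule.span K (Mon K k)

/-- Properties (1)-(4) of the families `U(2^m)`, `V(2^m)` of subspaces of `A(2^m)`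
(Section 1 of the paper):
(1) `V(2^m)` is spanned by monomials (of degree `2^m`);
(2) `V(2^m) + U(2^m) = A(2^m)` and `V(2^m) ∩ U(2^m) = 0`;
(3) `A(2^{m-1})U(2^{m-1}) + U(2^{m-1})A(2^{m-1}) ⊆ U(2^m)`;
(4) `V(2^m) ⊆ V(2^{m-1})V(2^{m-1})`;
with `V(2^0) = Kx + Ky` and `U(2^0) = 0`. -/
def UVCond (U V : ℕ → Submodule K (FA K)) : Prop :=
  V 0 = Submodule.span K {FreeAlgebra.ι K 0, FreeAlgebra.ι K 1} ∧
  U 0 = ⊥ ∧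
  ∀ m : ℕ, 1 ≤ m →
    (∃ s ⊆ Mon K (2 ^ m), V m = Submodule.span K s) ∧
    U m ≤ Adeg K (2 ^ m) ∧
    V m ⊔ U m = Adeg K (2 ^ m) ∧
    V m ⊓ U m = ⊥ ∧
    Adeg K (2 ^ (m - 1)) * U (m - 1) ⊔ U (m - 1) * Adeg K (2 ^ (m - 1)) ≤ U m ∧
    V m ≤ V (m - 1) * V (m - 1)

/-- The homogeneous component `E(k)` (as a set), for `k ≥ 1`.  For the unique `n` with
`2^(n-1) ≤ k < 2^n` (i.e. `n = Nat.log 2 k + 1`) it consists of those `r ∈ A(k)` with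
`A r A ∩ A(2^(n+1)) ⊆ U(2^n)A(2^n) + A(2^n)U(2^n)`; here `A r A` is the two-sided ideal
generated by `r`, realized as the subspace `⊤ * span{r} * ⊤`. -/
def ESet (U : ℕ → Submodule K (FA K)) (k : ℕ) : Set (FA K) :=
  { r | r ∈ Adeg K k ∧
    (⊤ : Submodule K (FA K)) * Submodule.span K {r} * ⊤ ⊓ Adeg K (2 ^ (Nat.log 2 k + 2)) ≤
      U (Nat.log 2 k + 1) * Adeg K (2 ^ (Nat.log 2 k + 1)) ⊔
        Adeg K (2 ^ (Nat.log 2 k + 1)) * U (Nat.log 2 k + 1) }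

/-- The graded subspace `E = ⊕_{k ≥ 1} E(k)` (each `E(k)` is a subspace, so the span of the
union of the `E(k)` is their direct sum). -/
def Esub (U : ℕ → Submodule K (FA K)) : Submodule K (FA K) :=
  Submodule.span K (⋃ k ∈ Set.Ici 1, ESet K U k)

/-- Auxiliary: the product of the `V(2^p)` over the set bits of `k`, lowest bit first,
with bit positions shifted by `i`. -/
def prodLow (V : ℕ → Submodule K (FA K)) (i k : ℕ) : Submodule K (FA K) :=
  if _h : k = 0 then 1
  else (if k % 2 = 1 then V i else 1) * prodLow V (i + 1) (k / 2)
termination_by k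
decreasing_by exact Nat.div_lt_self (Nat.pos_of_ne_zero _h) one_lt_two

/-- Auxiliary: the product of the `V(2^p)` over the set bits of `k`, highest bit first. -/
def prodHigh (V : ℕ → Submodule K (FA K)) (i k : ℕ) : Submodule K (FA K) :=
  if _h : k = 0 then 1
  else prodHigh V (i + 1) (k / 2) * (if k % 2 = 1 then V i else 1)
termination_by k
decreasing_by exact Nat.div_lt_self (Nat.pos_of_ne_zero _h) one_lt_two

/-- `V^<(k) = V(2^{p_1}) ⋯ V(2^{p_t})` where `k = 2^{p_1} + ⋯ + 2^{p_t}` in binary with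
`p_1 < ⋯ < p_t`; `V^<(0) = K·1`. -/
def Vlt (V : ℕ → Submodule K (FA K)) (k : ℕ) : Submodule K (FA K) := prodLow K V 0 k

/-- `V^>(k) = V(2^{p_t}) ⋯ V(2^{p_1})`; `V^>(0) = K·1`. -/
def Vgt (V : ℕ → Submodule K (FA K)) (k : ℕ) : Submodule K (FA K) := prodHigh K V 0 k

/-- `U^<(k) = Σ_i A(2^{p_1}+⋯+2^{p_{i-1}}) U(2^{p_i}) A(2^{p_{i+1}}+⋯+2^{p_t})`
(for each set bit `p_i` of `k`, the lower part of `k` is `k % 2^{p_i}` and the upper part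
is `k - k % 2^{p_i} - 2^{p_i}`); `U^<(0) = 0`. -/
def Ult (U : ℕ → Submodule K (FA K)) (k : ℕ) : Submodule K (FA K) :=
  ⨆ (p : ℕ) (_ : k.testBit p),
    Adeg K (k % 2 ^ p) * U p * Adeg K (k - k % 2 ^ p - 2 ^ p)

/-- `U^>(k) = Σ_i A(2^{p_t}+⋯+2^{p_{i+1}}) U(2^{p_i}) A(2^{p_{i-1}}+⋯+2^{p_1})`;
`U^>(0) = 0`. -/
def Ugt (U : ℕ → Submodule K (FA K)) (k : ℕ) : Submodule K (FA K) :=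
  ⨆ (p : ℕ) (_ : k.testBit p),
    Adeg K (k - k % 2 ^ p - 2 ^ p) * U p * Adeg K (k % 2 ^ p)

/-- The Capelli polynomial
`d_n(x_1,…,x_n; y_1,…,y_n) = Σ_{σ ∈ Sym(n)} sgn(σ) x_{σ(1)} y_1 x_{σ(2)} y_2 ⋯ x_{σ(n)} y_n`,
evaluated in a ring. -/
def capelli {R : Type*} [Ring R] (n : ℕ) (x y : Fin n → R) : R :=
  ∑ σ : Equiv.Perm (Fin n),
    (Equiv.Perm.sign σ : ℤ) • ((List.finRange n).map fun i => x (σ i) * y i).prod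

/-- The quotient map `R → R ⧸ c` (for a ring congruence `c`) as a `K`-linear map. -/
def mkLin {R : Type*} [Semiring R] [Algebra K R] (c : RingCon R) :
    R →ₗ[K] c.Quotient where
  toFun := RingCon.toQuotient
  map_add' _ _ := rfl
  map_smul' _ _ := rfl

/-- A two-sided ideal of the free algebra is homogeneous iff it is spanned by its
homogeneous elements. -/
def IsHomogTSI (J : TwoSidedIdeal (FA K)) : Prop :=
  (J : Set (FA K)) ⊆ ↑(Submodule.span K {a : FA K | a ∈ J ∧ ∃ n, a ∈ Adeg K n})

/-- `S = ⋃_{n ∈ Y} {n - e(n) - 1, …, n - 1}`. -/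
def SetS (Y : Set ℕ) (e : ℕ → ℕ) : Set ℕ :=
  ⋃ n ∈ Y, Set.Icc (n - e n - 1) (n - 1)

/-- Conditions (1)-(8) of Theorem 4.1 of the paper, at index `m`, for the families
`F(2^m)`, `U(2^m)`, `V(2^m)` of subspaces of `A(2^m)`:
(1) `dim V(2^m) = 2` if `m ∉ S` and (in case `Y` is finite) `m ≤ max Y`;
(2) `dim V(2^{k-e(k)-1+j}) = 2^{2^j}` for all `k ∈ Y` and `0 ≤ j ≤ e(k)`;
(3) `V(2^m)` is spanned by monomials;
(4) `F(2^m) ⊆ U(2^m)` for `m ∈ Y`, and `F(2^m) = 0` for `m ∉ Y`;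
(5) `V(2^m) ⊕ U(2^m) = A(2^m)`;
(6) `A(2^{m-1})U(2^{m-1}) + U(2^{m-1})A(2^{m-1}) ⊆ U(2^m)`;
(7) `V(2^m) ⊆ V(2^{m-1})V(2^{m-1})`;
(8) if `Y` is finite and `m > max Y`, then `dim V(2^m) = 1`. -/
def Conds (Y : Set ℕ) (e : ℕ → ℕ) (F U V : ℕ → Submodule K (FA K)) (m : ℕ) : Prop :=
  (m ∉ SetS Y e → (Y.Finite → ∃ k ∈ Y, m ≤ k) → Module.finrank K (V m) = 2) ∧
  (∀ k ∈ Y, ∀ j ≤ e k, k - e k - 1 + j = m → Module.finrank K (V m) = 2 ^ 2 ^ j) ∧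
  (∃ s ⊆ Mon K (2 ^ m), V m = Submodule.span K s) ∧
  (m ∈ Y → F m ≤ U m) ∧ (m ∉ Y → F m = ⊥) ∧
  U m ≤ Adeg K (2 ^ m) ∧
  V m ⊔ U m = Adeg K (2 ^ m) ∧ V m ⊓ U m = ⊥ ∧
  (Adeg K (2 ^ (m - 1)) * U (m - 1) ⊔ U (m - 1) * Adeg K (2 ^ (m - 1)) ≤ U m) ∧
  V m ≤ V (m - 1) * V (m - 1) ∧
  (Y.Finite → (∀ k ∈ Y, k < m) → Module.finrank K (V m) = 1)

theorem rank_submodule_mul_le {A : Type} [Ring A] [Algebra K A] (M N : Submodule K A) :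
    Module.rank K ↥(M * N) ≤ Module.rank K M * Module.rank K N := by
  rw [← Submodule.mulMap_range, ← rank_tensorProduct']
  exact rank_range_le _

/-- A product of spaces `V(2^p)` of dimension at most `2` over the binary digits of `k` has
dimension at most `k + 1`. -/
theorem rank_prodHigh_le (V : ℕ → Submodule K (FA K)) (i k : ℕ)
    (h : ∀ p, k.testBit p → Module.rank K (V (i + p)) ≤ 2) :
    Module.rank K (prodHigh K V i k) ≤ ((k + 1 : ℕ) : Cardinal) := by
  induction k using Nat.strong_induction_on generalizing i with
  | _ k ih =>
    have rank_one : Module.rank K (1 : Submodule K (FA K)) ≤ 1 := by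
      rw [Submodule.one_eq_span]
      exact (rank_span_le _).trans (by simp)
    rw [prodHigh]
    by_cases h0 : k = 0
    · rw [dif_pos h0]
      exact rank_one.trans (by simp [h0])
    rw [dif_neg h0]
    have key := ih (k / 2) (by omega) (i + 1) fun p hp => by
      rw [add_assoc, add_comm 1 p]
      exact h (p + 1) (by rwa [Nat.testBit_succ])
    refine (rank_submodule_mul_le K _ _).trans ?_
    by_cases hk : k % 2 = 1
    · rw [if_pos hk]
      have hV : Module.rank K (V i) ≤ ((2 : ℕ) : Cardinal) := by
        simpa using h 0 (by simp [Nat.testBit_zero, hk])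
      refine (mul_le_mul' key hV).trans ?_
      exact_mod_cast (by omega : (k / 2 + 1) * 2 ≤ k + 1)
    · rw [if_neg hk]
      refine (mul_le_mul' key rank_one).trans ?_
      rw [mul_one]
      exact_mod_cast (by omega : k / 2 + 1 ≤ k + 1)

/-- **Lemma 5.1.**  If no binary digit of `α` lies in `S`, then `dim V^>(α) ≤ 2α`. -/
theorem statement13 (Y : Set ℕ) (hY : ∀ n ∈ Y, 1 ≤ n) (e : ℕ → ℕ) (he : ∀ n ∈ Y, 1 ≤ e n)
    (hdisj : ∀ n ∈ Y, ∀ m ∈ Y, n ≠ m →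
      Disjoint (Set.Icc (n - e n - 1) (n - 1)) (Set.Icc (m - e m - 1) (m - 1)))
    (F U V : ℕ → Submodule K (FA K))
    (hV0 : V 0 = Submodule.span K {FreeAlgebra.ι K 0, FreeAlgebra.ι K 1})
    (hU0 : U 0 = ⊥)
    (hconds : ∀ m, 1 ≤ m → Conds K Y e F U V m)
    (α : ℕ) (hα : 1 ≤ α) (hbits : ∀ p, α.testBit p → p ∉ SetS Y e) :
    Module.rank K (Vgt K V α) ≤ ((2 * α : ℕ) : Cardinal) := by
  have rank_le : ∀ p, p ∉ SetS Y e → Module.rank K (V p) ≤ 2 := by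
    intro p hp
    rcases Nat.eq_zero_or_pos p with rfl | hpos
    · rw [hV0]
      exact (rank_span_le _).trans (by simp)
    obtain ⟨h2, -, -, -, -, -, -, -, -, -, h1⟩ := hconds p hpos
    have hfin : Module.finrank K (V p) = 1 ∨ Module.finrank K (V p) = 2 := by
      by_cases hbound : Y.Finite → ∃ k ∈ Y, p ≤ k
      · exact .inr (h2 hp hbound)
      · push Not at hbound
        exact .inl (h1 hbound.1 hbound.2)
    have : Module.Finite K (V p) := Module.finite_of_finrank_pos (by omega)
    rw [← Module.finrank_eq_rank]
    exact_mod_cast (by omega : Module.finrank K (V p) ≤ 2)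
  refine (rank_prodHigh_le K V 0 α fun p hp => ?_).trans ?_
  · rw [zero_add]
    exact rank_le p (hbits p hp)
  · exact_mod_cast (by omega : α + 1 ≤ 2 * α)

end
end

section
/- Suppose the families U(2^m), V(2^m), F(2^m) satisfy conditions (1)–(8) at every index m ≥ 1. Let α ≥ 1 be a natural number with binary expansion α = 2^{p_1} + ⋯ + 2^{p_t}, and suppose there is k ∈ Y such that p_i ∈ {k−e(k)−1, …, k−1} for all i = 1, …, t. Then dim_K V^>(α) = 2^{α / 2^{k−e(k)−1}} and in particular dim_K V^>(α) ≤ 2^{2^{e(k)+1}}. -/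
/-
Formalization of statements from:
"Golod-Shafarevich algebras of a reduced number of defining relations" (A. Smoktunowicz).

`FA K` is the free associative unital `K`-algebra `A = K⟨x,y⟩` on two generators
(`FreeAlgebra.ι K 0` and `FreeAlgebra.ι K 1`), graded with the generators in degree 1.
-/

open scoped Pointwise Classical

noncomputable section

variable (K : Type) [Field K]

/-- The monomial of the free algebra attached to a word. -/
def wordMonomial : FreeMonoid (Fin 2) →* FA K := FreeMonoid.lift (FreeAlgebra.ι K)

theorem linearIndependent_wordMonomial : LinearIndependent K (wordMonomial K) := by
  have h : ⇑(wordMonomial K) = FreeAlgebra.basisFreeMonoid K (Fin 2) := by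
    ext w
    simp [FreeAlgebra.basisFreeMonoid, FreeAlgebra.equivMonoidAlgebraFreeMonoid, wordMonomial]
  rw [h]
  exact (FreeAlgebra.basisFreeMonoid K (Fin 2)).linearIndependent

/-- `W` is spanned by `d` distinct monomials of degree `n`. -/
def SpannedByMonomials (W : Submodule K (FA K)) (n d : ℕ) : Prop :=
  ∃ s : Finset (FreeMonoid (Fin 2)), (∀ w ∈ s, w.length = n) ∧ s.card = d ∧
    W = Submodule.span K (wordMonomial K '' s)

variable {K}

namespace SpannedByMonomials

theorem rank_eq {W : Submodule K (FA K)} {n d : ℕ} (h : SpannedByMonomials K W n d) :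
    Module.rank K W = (d : Cardinal) := by
  obtain ⟨s, -, rfl, rfl⟩ := h
  have hli := linearIndependent_wordMonomial K
  rw [rank_span_set ((hli.linearIndepOn (s : Set _)).id_image),
    Cardinal.mk_image_eq hli.injective]
  simp

theorem one : SpannedByMonomials K 1 0 1 := by
  refine ⟨{1}, by simp, by simp, ?_⟩
  simp [Submodule.one_eq_span]

theorem mul {W₁ W₂ : Submodule K (FA K)} {n₁ n₂ d₁ d₂ : ℕ}
    (h₁ : SpannedByMonomials K W₁ n₁ d₁) (h₂ : SpannedByMonomials K W₂ n₂ d₂) :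
    SpannedByMonomials K (W₁ * W₂) (n₁ + n₂) (d₁ * d₂) := by
  obtain ⟨s, hs, rfl, rfl⟩ := h₁
  obtain ⟨t, ht, rfl, rfl⟩ := h₂
  refine ⟨s * t, ?_, ?_, ?_⟩
  · intro w hw
    obtain ⟨u, hu, v, hv, rfl⟩ := Finset.mem_mul.1 hw
    rw [FreeMonoid.length_mul, hs u hu, ht v hv]
  · refine Finset.card_mul_iff.2 ?_
    rintro ⟨u, v⟩ ⟨hu, hv⟩ ⟨u', v'⟩ ⟨hu', hv'⟩ h
    obtain ⟨h₁, h₂⟩ := List.append_inj (s₁ := u.toList) (t₁ := v.toList) (s₂ := u'.toList)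
      (t₂ := v'.toList) (congrArg FreeMonoid.toList h) ((hs u hu).trans (hs u' hu').symm)
    exact Prod.ext (FreeMonoid.toList.injective h₁) (FreeMonoid.toList.injective h₂)
  · rw [Submodule.span_mul_span, Finset.coe_mul, Set.image_mul]

theorem of_span {s : Set (FA K)} {n : ℕ} (hs : s ⊆ Mon K n) :
    SpannedByMonomials K (Submodule.span K s) n (Module.finrank K (Submodule.span K s)) := by
  have hfin : {w : FreeMonoid (Fin 2) | w.length = n}.Finite := List.finite_length_eq (Fin 2) n
  have hfin' : ({w | w.length = n ∧ wordMonomial K w ∈ s} : Set (FreeMonoid (Fin 2))).Finite :=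
    hfin.subset fun w hw => hw.1
  have himg : wordMonomial K '' hfin'.toFinset = s := by
    ext m
    simp only [Set.Finite.coe_toFinset, Set.mem_image, Set.mem_ofPred_eq]
    constructor
    · rintro ⟨w, ⟨-, hw⟩, rfl⟩
      exact hw
    · intro hm
      obtain ⟨w, hw, rfl⟩ := hs hm
      have hw' : wordMonomial K (FreeMonoid.ofList w) = (w.map (FreeAlgebra.ι K)).prod := by
        simp [wordMonomial, FreeMonoid.lift_ofList]
      exact ⟨FreeMonoid.ofList w, ⟨hw, hw' ▸ hm⟩, hw'⟩
  have h : SpannedByMonomials K (Submodule.span K s) n hfin'.toFinset.card :=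
    ⟨hfin'.toFinset, by simp +contextual, rfl, by rw [himg]⟩
  have hcard : Module.finrank K (Submodule.span K s) = hfin'.toFinset.card :=
    Module.finrank_eq_of_rank_eq h.rank_eq
  rwa [hcard]

theorem span_generators :
    SpannedByMonomials K
      (Submodule.span K {FreeAlgebra.ι K (0 : Fin 2), FreeAlgebra.ι K 1}) 1 2 := by
  refine ⟨{FreeMonoid.of 0, FreeMonoid.of 1}, by simp, ?_, ?_⟩
  · exact Finset.card_pair fun h => zero_ne_one (FreeMonoid.of_injective h)
  · simp [Set.image_insert_eq, wordMonomial]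

/-- If each `V p` with `p` a bit position in use has dimension `2 ^ (2 ^ p / 2 ^ a)`, then the
exponents add up along the binary expansion. -/
theorem prodHigh_of_testBit {V : ℕ → Submodule K (FA K)} {a : ℕ} (j i : ℕ)
    (h : ∀ p, j.testBit p → a ≤ i + p ∧
      SpannedByMonomials K (V (i + p)) (2 ^ (i + p)) (2 ^ 2 ^ (i + p - a))) :
    SpannedByMonomials K (prodHigh K V i j) (j * 2 ^ i) (2 ^ (j * 2 ^ i / 2 ^ a)) := by
  induction j using Nat.strong_induction_on generalizing i with
  | _ j ih =>
    rw [prodHigh]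
    split_ifs with h0 h1
    · subst h0
      simpa using one
    · have ih' := ih (j / 2) (Nat.div_lt_self (Nat.pos_of_ne_zero h0) one_lt_two) (i + 1)
        fun p hp => by
          have := h (p + 1) (by rwa [Nat.testBit_succ])
          rwa [show i + 1 + p = i + (p + 1) by omega]
      obtain ⟨hai, hV⟩ := h 0 (by simp [Nat.testBit_zero, h1])
      rw [add_zero] at hai hV
      have hj : j * 2 ^ i = j / 2 * 2 ^ (i + 1) + 2 ^ i := by
        conv_lhs => rw [← Nat.div_add_mod j 2, h1]
        ring
      have hdvd : 2 ^ a ∣ 2 ^ i := pow_dvd_pow 2 hai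
      rw [hj, Nat.add_div_of_dvd_left hdvd, pow_add 2 (_ / _), Nat.pow_div hai two_pos]
      exact ih'.mul hV
    · have ih' := ih (j / 2) (Nat.div_lt_self (Nat.pos_of_ne_zero h0) one_lt_two) (i + 1)
        fun p hp => by
          have := h (p + 1) (by rwa [Nat.testBit_succ])
          rwa [show i + 1 + p = i + (p + 1) by omega]
      have hj : j * 2 ^ i = j / 2 * 2 ^ (i + 1) := by
        conv_lhs => rw [← Nat.div_add_mod j 2, show j % 2 = 0 by omega]
        ring
      rwa [mul_one, hj]

end SpannedByMonomials

variable (K)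

/-- **Lemma 5.2.**  If every binary digit of `α` lies in `S_k = {k−e(k)−1, …, k−1}` for
some fixed `k ∈ Y`, then `dim V^>(α) = 2^{α/2^{k−e(k)−1}} ≤ 2^{2^{e(k)+1}}`. -/
theorem statement14 (Y : Set ℕ) (hY : ∀ n ∈ Y, 1 ≤ n) (e : ℕ → ℕ) (he : ∀ n ∈ Y, 1 ≤ e n)
    (hdisj : ∀ n ∈ Y, ∀ m ∈ Y, n ≠ m →
      Disjoint (Set.Icc (n - e n - 1) (n - 1)) (Set.Icc (m - e m - 1) (m - 1)))
    (F U V : ℕ → Submodule K (FA K))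
    (hV0 : V 0 = Submodule.span K {FreeAlgebra.ι K 0, FreeAlgebra.ι K 1})
    (hU0 : U 0 = ⊥)
    (hconds : ∀ m, 1 ≤ m → Conds K Y e F U V m)
    (α : ℕ) (hα : 1 ≤ α)
    (k : ℕ) (hk : k ∈ Y)
    (hbits : ∀ p, α.testBit p → p ∈ Set.Icc (k - e k - 1) (k - 1)) :
    Module.rank K (Vgt K V α) = ((2 ^ (α / 2 ^ (k - e k - 1)) : ℕ) : Cardinal) ∧
    Module.rank K (Vgt K V α) ≤ ((2 ^ 2 ^ (e k + 1) : ℕ) : Cardinal) := by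
  have hk1 := hY k hk
  have hV : ∀ p ∈ Set.Icc (k - e k - 1) (k - 1),
      SpannedByMonomials K (V p) (2 ^ p) (2 ^ 2 ^ (p - (k - e k - 1))) := by
    rintro p ⟨hp₁, hp₂⟩
    rcases Nat.eq_zero_or_pos p with rfl | hp
    · rw [hV0]
      simpa using SpannedByMonomials.span_generators
    · obtain ⟨-, hdim, ⟨s, hs, hspan⟩, -⟩ := hconds p hp
      rw [← hdim k hk (p - (k - e k - 1)) (by omega) (by omega), hspan]
      exact SpannedByMonomials.of_span hs
  have hrank : Module.rank K (Vgt K V α) = ((2 ^ (α / 2 ^ (k - e k - 1)) : ℕ) : Cardinal) := by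
    have h := SpannedByMonomials.prodHigh_of_testBit (V := V) (a := k - e k - 1) α 0
      fun p hp => by
        rw [zero_add]
        exact ⟨(hbits p hp).1, hV p (hbits p hp)⟩
    rw [pow_zero, mul_one] at h
    exact h.rank_eq
  refine ⟨hrank, hrank.trans_le (Nat.cast_le.2 (Nat.pow_le_pow_right two_pos ?_))⟩
  have hα_lt : α < 2 ^ k := Nat.lt_pow_two_of_testBit α fun p hp => by
    by_contra hbit
    have := (hbits p (by simpa using hbit)).2
    omega
  refine Nat.div_le_of_le_mul (hα_lt.le.trans ?_)
  rw [← pow_add]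
  exact Nat.pow_le_pow_right two_pos (by omega)

end
end

section
/- Suppose the families U(2^m), V(2^m), F(2^m) satisfy conditions (1)–(8) at every index m ≥ 1. Let α, β ≥ 0 be natural numbers such that α + β ≤ 2^{n−1} + 2^{n−2} for some n ∈ Y. Then (dim_K V^<(α)) · (dim_K V^>(β)) ≤ 2^{2n} · (∏_{k∈Y, k<n} 2^{2^{e(k)+1}})^2 · (dim_K V(2^{n−1}))^2 / 2^{2^{e(n)−1}}. -/
/-
Formalization of statements from:
"Golod-Shafarevich algebras of a reduced number of defining relations" (A. Smoktunowicz).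

`FA K` is the free associative unital `K`-algebra `A = K⟨x,y⟩` on two generators
(`FreeAlgebra.ι K 0` and `FreeAlgebra.ι K 1`), graded with the generators in degree 1.
-/

open scoped Pointwise Classical

noncomputable section

variable (K : Type) [Field K]

variable {K} in
theorem rank_mul_le (M N : Submodule K (FA K)) :
    Module.rank K (M * N : Submodule K (FA K)) ≤ Module.rank K M * Module.rank K N := by
  rw [← rank_tensorProduct', ← Submodule.mulMap_range]
  exact rank_range_le _

theorem rank_one_le_one : Module.rank K (1 : Submodule K (FA K)) ≤ 1 := by
  rw [Submodule.one_eq_span]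
  simpa using rank_span_le (R := K) ({1} : Set (FA K))

theorem sum_testBit_range_succ (f : ℕ → ℕ) (N k : ℕ) :
    (∑ j ∈ Finset.range (N + 1), if k.testBit j then f j else 0) =
      (if k % 2 = 1 then f 0 else 0) +
        ∑ j ∈ Finset.range N, if (k / 2).testBit j then f (j + 1) else 0 := by
  rw [Finset.sum_range_succ', add_comm]
  simp [Nat.testBit_succ, Nat.testBit_zero]

theorem sum_testBit_two_pow (N : ℕ) :
    ∀ k < 2 ^ N, (∑ j ∈ Finset.range N, if k.testBit j then 2 ^ j else 0) = k := by
  induction N with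
  | zero => intro k hk; simp at hk; simp [hk]
  | succ N ih =>
    intro k hk
    have h := ih (k / 2) (by rw [pow_succ] at hk; omega)
    have h2 : (∑ j ∈ Finset.range N, if (k / 2).testBit j then 2 ^ (j + 1) else 0) =
        2 * (k / 2) := by
      conv_rhs => rw [← h]
      rw [Finset.mul_sum]
      exact Finset.sum_congr rfl fun j _ => by split_ifs <;> ring
    rw [sum_testBit_range_succ, h2]
    split_ifs <;> simp <;> omega

theorem rank_ite_le (V : Submodule K (FA K)) (w : ℕ) (p : Prop) [Decidable p]
    (h : Module.rank K V ≤ 2 ^ w) :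
    Module.rank K (if p then V else 1 : Submodule K (FA K)) ≤ 2 ^ (if p then w else 0) := by
  by_cases hp : p
  · rwa [if_pos hp, if_pos hp]
  · rw [if_neg hp, if_neg hp, pow_zero]
    exact rank_one_le_one K

theorem rank_prodLow_le (V : ℕ → Submodule K (FA K)) (N : ℕ) :
    ∀ (w : ℕ → ℕ) (i k : ℕ), k < 2 ^ N →
      (∀ j < N, Module.rank K (V (i + j)) ≤ 2 ^ w j) →
      Module.rank K (prodLow K V i k) ≤
        2 ^ ∑ j ∈ Finset.range N, if k.testBit j then w j else 0 := by
  induction N with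
  | zero =>
    intro w i k hk _
    obtain rfl : k = 0 := by simpa using hk
    rw [prodLow]
    simpa using rank_one_le_one K
  | succ N ih =>
    intro w i k hk hw
    by_cases h0 : k = 0
    · subst h0
      rw [prodLow]
      simpa using rank_one_le_one K
    rw [prodLow, dif_neg h0, sum_testBit_range_succ, pow_add]
    refine (rank_mul_le _ _).trans (mul_le_mul' ?_ ?_)
    · exact rank_ite_le K _ _ _ (hw 0 (by omega))
    · refine ih (fun j => w (j + 1)) (i + 1) (k / 2) (by rw [pow_succ] at hk; omega) ?_
      intro j hj
      have := hw (j + 1) (by omega)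
      rwa [show i + 1 + j = i + (j + 1) by ring]

theorem rank_prodHigh_le_s16 (V : ℕ → Submodule K (FA K)) (N : ℕ) :
    ∀ (w : ℕ → ℕ) (i k : ℕ), k < 2 ^ N →
      (∀ j < N, Module.rank K (V (i + j)) ≤ 2 ^ w j) →
      Module.rank K (prodHigh K V i k) ≤
        2 ^ ∑ j ∈ Finset.range N, if k.testBit j then w j else 0 := by
  induction N with
  | zero =>
    intro w i k hk _
    obtain rfl : k = 0 := by simpa using hk
    rw [prodHigh]
    simpa using rank_one_le_one K
  | succ N ih =>
    intro w i k hk hw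
    by_cases h0 : k = 0
    · subst h0
      rw [prodHigh]
      simpa using rank_one_le_one K
    rw [prodHigh, dif_neg h0, sum_testBit_range_succ, pow_add, mul_comm]
    refine (rank_mul_le _ _).trans (mul_le_mul' ?_ ?_)
    · refine ih (fun j => w (j + 1)) (i + 1) (k / 2) (by rw [pow_succ] at hk; omega) ?_
      intro j hj
      have := hw (j + 1) (by omega)
      rwa [show i + 1 + j = i + (j + 1) by ring]
    · exact rank_ite_le K _ _ _ (hw 0 (by omega))

theorem sum_two_pow_sub_le (c s t : ℕ) :
    (∑ j ∈ Finset.range c, if j ∈ Set.Icc s (s + t) then 2 ^ (j - s) else 0) ≤ 2 ^ (t + 1) := by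
  calc (∑ j ∈ Finset.range c, if j ∈ Set.Icc s (s + t) then 2 ^ (j - s) else 0)
      = ∑ j ∈ (Finset.range c).filter (· ∈ Set.Icc s (s + t)), 2 ^ (j - s) := by
        rw [Finset.sum_filter]
    _ ≤ ∑ j ∈ Finset.Ico s (s + t + 1), 2 ^ (j - s) := by
        refine Finset.sum_le_sum_of_subset fun j hj => ?_
        simp only [Finset.mem_filter, Set.mem_Icc, Finset.mem_Ico] at hj ⊢
        omega
    _ = ∑ j ∈ Finset.range (t + 1), 2 ^ j := by
        rw [Finset.sum_Ico_eq_sum_range]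
        simp [add_assoc]
    _ ≤ 2 ^ (t + 1) := by
        rw [Nat.geomSum_eq le_rfl]
        simp

/-- The weight bounding `log₂ dim V(2^j)` for `j < n`, where `c = n - e n - 1` is the least
element of `S_n`. -/
def dimWeight (Y : Set ℕ) (e : ℕ → ℕ) (n c j : ℕ) : ℕ :=
  if c ≤ j then 2 ^ (j - c)
  else 1 + ∑ k ∈ Finset.range n, if k ∈ Y then
    (if j ∈ Set.Icc (k - e k - 1) (k - e k - 1 + e k) then 2 ^ (j - (k - e k - 1)) else 0) else 0

theorem sum_dimWeight_le (Y : Set ℕ) (e : ℕ → ℕ) (n c : ℕ) :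
    ∑ j ∈ Finset.range c, dimWeight Y e n c j ≤
      c + ∑ k ∈ Finset.range n, if k ∈ Y then 2 ^ (e k + 1) else 0 := by
  calc ∑ j ∈ Finset.range c, dimWeight Y e n c j
      = ∑ j ∈ Finset.range c, (1 + ∑ k ∈ Finset.range n, if k ∈ Y then
          (if j ∈ Set.Icc (k - e k - 1) (k - e k - 1 + e k)
            then 2 ^ (j - (k - e k - 1)) else 0) else 0) :=
        Finset.sum_congr rfl fun j hj => if_neg (by simpa using hj)
    _ ≤ _ := by
        rw [Finset.sum_add_distrib, Finset.sum_comm]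
        refine add_le_add (by simp) (Finset.sum_le_sum fun k _ => ?_)
        split_ifs with hk
        · exact sum_two_pow_sub_le _ _ _
        · simp

theorem sum_testBit_dimWeight_le (Y : Set ℕ) (e : ℕ → ℕ) (c d a : ℕ) (ha : a < 2 ^ (c + d)) :
    (∑ j ∈ Finset.range (c + d), if a.testBit j then dimWeight Y e (c + d) c j else 0) ≤
      c + (∑ k ∈ Finset.range (c + d), if k ∈ Y then 2 ^ (e k + 1) else 0) + a / 2 ^ c := by
  rw [Finset.sum_range_add]
  refine add_le_add (le_trans (Finset.sum_le_sum fun j _ => ?_)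
    (sum_dimWeight_le Y e (c + d) c)) (le_of_eq ?_)
  · split_ifs <;> simp
  · rw [← sum_testBit_two_pow d (a / 2 ^ c)
      (Nat.div_lt_of_lt_mul (by rwa [← pow_add]))]
    refine Finset.sum_congr rfl fun j _ => ?_
    rw [Nat.testBit_div_two_pow]
    simp [dimWeight, add_comm]

variable {K} in
theorem rank_eq_two_pow_of_finrank {V : Submodule K (FA K)} {t : ℕ}
    (h : Module.finrank K V = 2 ^ t) : Module.rank K V = 2 ^ t := by
  have : Module.Finite K V := Module.finite_of_finrank_pos (by rw [h]; positivity)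
  rw [← Module.finrank_eq_rank, h]
  push_cast
  rfl

/-- **Lemma 5.4.**  If `α + β ≤ 2^{n−1} + 2^{n−2}` for some `n ∈ Y`, then
`dim V^<(α) · dim V^>(β) ≤ 2^{2n} (∏_{k∈Y,k<n} 2^{2^{e(k)+1}})² (dim V(2^{n−1}))² / 2^{2^{e(n)−1}}`
(stated multiplicatively, with the divisor `2^{2^{e(n)−1}}` moved to the left-hand side). -/
theorem statement16 (Y : Set ℕ) (hY : ∀ n ∈ Y, 1 ≤ n) (e : ℕ → ℕ) (he : ∀ n ∈ Y, 1 ≤ e n)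
    (hdisj : ∀ n ∈ Y, ∀ m ∈ Y, n ≠ m →
      Disjoint (Set.Icc (n - e n - 1) (n - 1)) (Set.Icc (m - e m - 1) (m - 1)))
    (F U V : ℕ → Submodule K (FA K))
    (hV0 : V 0 = Submodule.span K {FreeAlgebra.ι K 0, FreeAlgebra.ι K 1})
    (hU0 : U 0 = ⊥)
    (hconds : ∀ m, 1 ≤ m → Conds K Y e F U V m)
    (α β n : ℕ) (hn : n ∈ Y) (hsum : α + β ≤ 2 ^ (n - 1) + 2 ^ (n - 2)) :
    Module.rank K (Vlt K V α) * Module.rank K (Vgt K V β) *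
        ((2 ^ 2 ^ (e n - 1) : ℕ) : Cardinal) ≤
      ((2 ^ (2 * n) *
          (∏ k ∈ Finset.range n, if k ∈ Y then 2 ^ 2 ^ (e k + 1) else 1) ^ 2 : ℕ) :
        Cardinal) * Module.rank K (V (n - 1)) ^ 2 := by
  have hdim : ∀ k ∈ Y, ∀ j ≤ e k, 1 ≤ k - e k - 1 + j →
      Module.finrank K (V (k - e k - 1 + j)) = 2 ^ 2 ^ j :=
    fun k hk j hj h => (hconds _ h).2.1 k hk j hj rfl
  have hzero : Module.rank K (V 0) ≤ 2 ^ 1 := by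
    rw [hV0]
    refine (rank_span_le _).trans ?_
    refine (Cardinal.mk_insert_le).trans ?_
    rw [Cardinal.mk_singleton, pow_one, one_add_one_eq_two]
  have hrank : ∀ k ∈ Y, ∀ j ≤ e k, Module.rank K (V (k - e k - 1 + j)) ≤ 2 ^ 2 ^ j := by
    intro k hk j hj
    rcases Nat.eq_zero_or_pos (k - e k - 1 + j) with h | h
    · obtain rfl : j = 0 := by omega
      rw [h]
      simpa using hzero
    · exact (rank_eq_two_pow_of_finrank (hdim k hk j hj h)).le
  have hn1 := hY n hn
  have hen1 := he n hn
  have hen : e n + 1 ≤ n := by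
    by_contra hlt
    have hc : n - e n - 1 = 0 := by omega
    have h2 : Module.finrank K (V n) = 2 := by
      by_cases hS : n ∈ SetS Y e
      · simp only [SetS, Set.mem_iUnion, Set.mem_Icc] at hS
        obtain ⟨k, hk, h1, h2⟩ := hS
        have hkn : n ≠ k := by omega
        have hd := Set.disjoint_left.1 (hdisj n hn k hk hkn)
        have hd' := @hd (n - 1) (by simp [hc])
        have hs : k - e k - 1 = n := by
          simp only [Set.mem_Icc] at hd'
          omega
        have := hdim k hk 0 (by omega) (by omega)
        rw [hs, add_zero] at this
        simpa using this
      · exact (hconds n hn1).1 hS fun _ => ⟨n, hn, le_rfl⟩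
    have h3 := hdim n hn n (by omega) (by omega)
    rw [hc, zero_add, h2] at h3
    have h4 : 2 ^ 1 ≤ 2 ^ n := Nat.pow_le_pow_right (by norm_num) hn1
    have h5 : 2 ^ 2 ≤ 2 ^ 2 ^ n := Nat.pow_le_pow_right (by norm_num) (by simpa using h4)
    omega
  obtain ⟨c, hc⟩ : ∃ c, n = c + (e n + 1) := ⟨n - (e n + 1), by omega⟩
  have hs : n - e n - 1 = c := by omega
  have hw : ∀ j < n, Module.rank K (V (0 + j)) ≤ 2 ^ dimWeight Y e n c j := by
    intro j hj
    rw [zero_add, dimWeight]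
    split_ifs with hcj
    · have := hrank n hn (j - c) (by omega)
      rwa [hs, show c + (j - c) = j by omega] at this
    · by_cases hS : j ∈ SetS Y e
      · simp only [SetS, Set.mem_iUnion, Set.mem_Icc] at hS
        obtain ⟨k, hk, h1, h2⟩ := hS
        have hkn : k < n := by
          by_contra hge
          rcases Nat.lt_or_ge n k with h | h
          · have hd := Set.disjoint_left.1 (hdisj n hn k hk (by omega))
            have hd' := @hd c (by simp only [Set.mem_Icc]; omega)
            simp only [Set.mem_Icc] at hd'
            omega
          · obtain rfl : k = n := by omega
            omega
        have hk1 := hY k hk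
        have hj' := hrank k hk (j - (k - e k - 1)) (by omega)
        rw [show k - e k - 1 + (j - (k - e k - 1)) = j by omega] at hj'
        refine hj'.trans (pow_le_pow_right₀ one_le_two (le_add_left ?_))
        refine le_trans (le_of_eq ?_) (Finset.single_le_sum (fun _ _ => Nat.zero_le _)
          (Finset.mem_range.2 hkn))
        rw [if_pos hk, if_pos (Set.mem_Icc.2 (by omega))]
      · refine le_trans ?_ (pow_le_pow_right₀ one_le_two (Nat.le_add_right 1 _))
        rcases Nat.eq_zero_or_pos j with rfl | hj0
        · exact hzero
        · refine (rank_eq_two_pow_of_finrank ?_).le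
          simpa using (hconds j hj0).1 hS fun _ => ⟨n, hn, hj.le⟩
  have hp1 : 2 ^ (n - 1) = 2 ^ c * 2 ^ e n := by rw [← pow_add]; congr 1; omega
  have hp2 : 2 ^ (n - 2) = 2 ^ c * 2 ^ (e n - 1) := by rw [← pow_add]; congr 1; omega
  have hp3 : 2 ^ e n = 2 * 2 ^ (e n - 1) := by rw [← pow_succ']; congr 1; omega
  have hp4 : 2 ^ n = 2 * 2 ^ (n - 1) := by rw [← pow_succ']; congr 1; omega
  have hp5 : 2 ^ (n - 1) = 2 * 2 ^ (n - 2) := by rw [← pow_succ']; congr 1; omega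
  have hp6 : 0 < 2 ^ (n - 2) := by positivity
  have hα : α < 2 ^ n := by omega
  have hβ : β < 2 ^ n := by omega
  have hdiv : α / 2 ^ c + β / 2 ^ c ≤ 2 ^ e n + 2 ^ (e n - 1) := by
    refine Nat.div_add_div_le_add_div.trans ?_
    refine Nat.div_le_of_le_mul ?_
    rwa [mul_add, ← hp1, ← hp2]
  have hA := rank_prodLow_le K V n _ 0 α hα hw
  have hB := rank_prodHigh_le_s16 K V n _ 0 β hβ hw
  have hAw := sum_testBit_dimWeight_le Y e c (e n + 1) α (hc ▸ hα)
  have hBw := sum_testBit_dimWeight_le Y e c (e n + 1) β (hc ▸ hβ)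
  rw [← hc] at hAw hBw
  have htop : Module.rank K (V (n - 1)) = 2 ^ 2 ^ e n := by
    have := rank_eq_two_pow_of_finrank (hdim n hn (e n) le_rfl (by omega))
    rwa [hs, show c + e n = n - 1 by omega] at this
  have hprod : (∏ k ∈ Finset.range n, if k ∈ Y then 2 ^ 2 ^ (e k + 1) else 1) =
      2 ^ ∑ k ∈ Finset.range n, if k ∈ Y then 2 ^ (e k + 1) else 0 := by
    rw [← Finset.prod_pow_eq_pow_sum]
    exact Finset.prod_congr rfl fun k _ => by split_ifs <;> simp
  rw [htop, hprod]
  refine (mul_le_mul' (mul_le_mul' hA hB) le_rfl).trans ?_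
  push_cast
  simp only [← pow_add, ← pow_mul]
  refine pow_le_pow_right₀ one_le_two ?_
  omega

end
end

section
/- Let K be an algebraically closed field, let n be a natural number, and let T ⊆ A(2^n) and Q ⊆ A(2^{n+1}) be K-linear subspaces such that dim_K T + 4·dim_K Q ≤ dim_K A(2^n) − 2 (note dim_K A(2^n) = 2^{2^n}). Then there exists a K-linear subspace F ⊆ A(2^n) of dimension at most dim_K A(2^n) − 2 such that T ⊆ F and Q ⊆ F·A(2^n) + A(2^n)·F. -/
/-
Formalization of statements from:
"Golod-Shafarevich algebras of a reduced number of defining relations" (A. Smoktunowicz).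

`FA K` is the free associative unital `K`-algebra `A = K⟨x,y⟩` on two generators
(`FreeAlgebra.ι K 0` and `FreeAlgebra.ι K 1`), graded with the generators in degree 1.
-/

open scoped Pointwise Classical

noncomputable section

variable (K : Type) [Field K]

open MvPolynomial in
/-- Over an algebraically closed field, fewer polynomials than variables vanishing at the origin
have a common zero other than the origin. -/
theorem MvPolynomial.exists_ne_zero_forall_eval_eq_zero {K σ ι : Type*} [Field K] [IsAlgClosed K]
    [Finite σ] [Finite ι] (P : ι → MvPolynomial σ K) (hP : ∀ i, MvPolynomial.eval 0 (P i) = 0)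
    (hcard : Nat.card ι < Nat.card σ) :
    ∃ z : σ → K, z ≠ 0 ∧ ∀ i, MvPolynomial.eval z (P i) = 0 := by
  by_contra! hne
  have hdim : ringKrullDim (MvPolynomial σ K) = Nat.card σ := by simp
  have : FiniteRingKrullDim (MvPolynomial σ K) := by
    rw [finiteRingKrullDim_iff_ne_bot_and_top, hdim]
    exact ⟨WithBot.natCast_ne_bot _,
      WithBot.coe_injective.ne (ENat.natCast_ne_top (Nat.card σ))⟩
  obtain ⟨M, hM, hMht⟩ := Ideal.exists_isMaximal_height (R := MvPolynomial σ K)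
  obtain ⟨x, hx⟩ := eq_vanishingIdeal_singleton_of_isMaximal K hM
  -- translate the given polynomials so that their common zero becomes `x`
  let τ : MvPolynomial σ K →ₐ[K] MvPolynomial σ K := aeval fun s => X s - C (x s)
  have hτ : ∀ z p, aeval z (τ p) = eval (z - x) p := by
    intro z p
    have : (aeval z).comp τ = aeval (z - x) := by
      ext s; simp [τ]
    simpa [coe_aeval_eq_eval] using congrArg (fun f => f p) this
  have hzero : zeroLocus K (Ideal.span (Set.range fun i => τ (P i))) = {x} := by
    rw [zeroLocus_span]
    ext z
    simp only [Set.mem_range, forall_exists_index, forall_apply_eq_imp_iff, Set.mem_ofPred_eq,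
      hτ, Set.mem_singleton_iff]
    constructor
    · intro h
      by_contra hzx
      obtain ⟨i, hi⟩ := hne (z - x) (sub_ne_zero.2 hzx)
      exact hi (h i)
    · rintro rfl i
      simpa using hP i
  have hrad : (Ideal.span (Set.range fun i => τ (P i))).radical = M := by
    rw [← vanishingIdeal_zeroLocus_eq_radical (K := K), hzero, hx]
  have hmin : M ∈ (Ideal.span (Set.range fun i => τ (P i))).minimalPrimes := by
    rw [← Ideal.radical_minimalPrimes, hrad, Ideal.minimalPrimes_eq_subsingleton_self]
    exact Set.mem_singleton M
  have h1 := Ideal.height_le_card_of_mem_minimalPrimes_span (Set.finite_range _) hmin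
  have h2 : (Set.range fun i => τ (P i)).ncard ≤ Nat.card ι := by
    rw [← Set.image_univ, ← Set.ncard_univ]
    exact Set.ncard_image_le Set.finite_univ
  rw [hdim] at hMht
  have h3 : M.height = Nat.card σ := by exact_mod_cast hMht
  rw [h3, Nat.cast_le] at h1
  omega

/-- The linear map `K^{r+1} → K²` pairing a vector `c` with the two shifts `(0, z)` and `(z, 0)`
of `z`. -/
def shiftPair {K : Type*} [Field K] {r : ℕ} (z : Fin r → K) :
    (Fin (r + 1) → K) →ₗ[K] (Fin 2 → K) :=
  LinearMap.pi fun a => ∑ i, z i • LinearMap.proj (![i.succ, i.castSucc] a)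

theorem shiftPair_apply {K : Type*} [Field K] {r : ℕ} (z : Fin r → K) (c : Fin (r + 1) → K)
    (a : Fin 2) : shiftPair z c a = ∑ i, z i * c (![i.succ, i.castSucc] a) := by
  simp [shiftPair]

theorem shiftPair_surjective {K : Type*} [Field K] {r : ℕ} {z : Fin r → K} (hz : z ≠ 0) :
    Function.Surjective (shiftPair z) := by
  obtain ⟨i, hi, hmin⟩ : ∃ i, z i ≠ 0 ∧ ∀ j < i, z j = 0 := by
    obtain ⟨i, hi⟩ := Function.ne_iff.1 hz
    obtain ⟨k, hk, hk'⟩ := WellFounded.has_min (r := (· < ·)) wellFounded_lt {i | z i ≠ 0} ⟨i, hi⟩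
    exact ⟨k, hk, fun j hj => by_contra fun h => hk' j h hj⟩
  have h0 : shiftPair z (Pi.single i.castSucc 1) 0 = 0 := by
    rw [shiftPair_apply]
    refine Finset.sum_eq_zero fun j _ => ?_
    by_cases h : j < i
    · simp [hmin j h]
    · have : j.succ ≠ i.castSucc := by
        rw [Ne, Fin.ext_iff]; simp; omega
      simp [this]
  have h1 : shiftPair z (Pi.single i.castSucc 1) 1 = z i := by
    rw [shiftPair_apply]
    simp [Pi.single_apply]
  have h2 : shiftPair z (Pi.single i.succ 1) 0 = z i := by
    rw [shiftPair_apply]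
    simp [Pi.single_apply]
  intro v
  refine ⟨(v 0 / z i) • Pi.single i.succ 1 + ((v 1 - v 0 / z i *
    shiftPair z (Pi.single i.succ 1) 1) / z i) • Pi.single i.castSucc 1, ?_⟩
  ext a
  fin_cases a
  · simp [h0, h2, hi]
  · simp [h1, hi]

open TensorProduct in
/-- Simultaneous vanishing of a subspace `T` and of finitely many tensors under a surjection
onto the plane. -/
theorem exists_surjective_pi_two {K W ι : Type*} [Field K] [IsAlgClosed K] [AddCommGroup W]
    [Module K W] [FiniteDimensional K W] [Finite ι] (T : Submodule K W) (t : ι → W ⊗[K] W)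
    (hdim : Module.finrank K T + 4 * Nat.card ι + 2 ≤ Module.finrank K W) :
    ∃ φ : W →ₗ[K] (Fin 2 → K), Function.Surjective φ ∧ T ≤ LinearMap.ker φ ∧
      ∀ i, TensorProduct.map φ φ (t i) = 0 := by
  obtain ⟨r, hr⟩ : ∃ r, Module.finrank K (W ⧸ T) = r + 1 :=
    ⟨Module.finrank K (W ⧸ T) - 1, by have := T.finrank_quotient_add_finrank; omega⟩
  have hcard : 4 * Nat.card ι < r := by have := T.finrank_quotient_add_finrank; omega
  let β : W →ₗ[K] (Fin (r + 1) → K) :=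
    (Module.finBasisOfFinrankEq K (W ⧸ T) hr).equivFun.toLinearMap ∘ₗ T.mkQ
  have hβ : Function.Surjective β :=
    (Module.finBasisOfFinrankEq K (W ⧸ T) hr).equivFun.surjective.comp T.mkQ_surjective
  have hT : T ≤ LinearMap.ker β := fun w hw => by
    simp [β, hw]
  let E := (Pi.basisFun K (Fin (r + 1))).tensorProduct (Pi.basisFun K (Fin (r + 1)))
  let E₂ := (Pi.basisFun K (Fin 2)).tensorProduct (Pi.basisFun K (Fin 2))
  have key : ∀ (z : Fin r → K) (s : W ⊗[K] W) (a b : Fin 2),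
      E₂.repr (TensorProduct.map (shiftPair z ∘ₗ β) (shiftPair z ∘ₗ β) s) (a, b) =
        ∑ i, ∑ j, E.repr (TensorProduct.map β β s)
          (![i.succ, i.castSucc] a, ![j.succ, j.castSucc] b) * (z i * z j) := by
    intro z s a b
    induction s with
    | zero => simp
    | add x y hx hy => simp only [map_add, Finsupp.add_apply, hx, hy, add_mul,
        Finset.sum_add_distrib]
    | tmul v w =>
      simp only [TensorProduct.map_tmul, E, E₂, Module.Basis.tensorProduct_repr_tmul_apply,
        Pi.basisFun_repr, LinearMap.comp_apply, shiftPair_apply, smul_eq_mul, Finset.sum_mul_sum]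
      rw [Finset.sum_comm]
      refine Finset.sum_congr rfl fun i _ => Finset.sum_congr rfl fun j _ => ?_
      ring
  let P : ι × Fin 2 × Fin 2 → MvPolynomial (Fin r) K := fun q =>
    ∑ i, ∑ j, MvPolynomial.C (E.repr (TensorProduct.map β β (t q.1))
      (![i.succ, i.castSucc] q.2.1, ![j.succ, j.castSucc] q.2.2)) *
        (MvPolynomial.X i * MvPolynomial.X j)
  obtain ⟨z, hz, hPz⟩ := MvPolynomial.exists_ne_zero_forall_eval_eq_zero P
    (fun q => by simp [P]) (by simp [Nat.card_prod]; omega)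
  refine ⟨shiftPair z ∘ₗ β, (shiftPair_surjective hz).comp hβ,
    fun w hw => by simp [LinearMap.mem_ker.1 (hT hw)], fun i => ?_⟩
  refine E₂.repr.map_eq_zero_iff.1 (Finsupp.ext fun ⟨a, b⟩ => ?_)
  rw [key]
  simpa [P] using hPz (i, a, b)

open TensorProduct in
theorem mem_sup_range_of_map_eq_zero {K W V : Type*} [Field K] [AddCommGroup W] [Module K W]
    [AddCommGroup V] [Module K V] {φ : W →ₗ[K] V} (hφ : Function.Surjective φ)
    {t : W ⊗[K] W} (ht : TensorProduct.map φ φ t = 0) :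
    t ∈ LinearMap.range ((LinearMap.ker φ).subtype.lTensor W) ⊔
      LinearMap.range ((LinearMap.ker φ).subtype.rTensor W) := by
  rw [← TensorProduct.map_ker (LinearMap.exact_subtype_ker_map φ) hφ
    (LinearMap.exact_subtype_ker_map φ) hφ]
  exact ht

open TensorProduct in
theorem map_mulMap_ker_le {K A V : Type*} [Field K] [Ring A] [Algebra K A] [AddCommGroup V]
    [Module K V] (W : Submodule K A) {φ : W →ₗ[K] V} (hφ : Function.Surjective φ)
    {t : W ⊗[K] W} (ht : TensorProduct.map φ φ t = 0) :
    W.mulMap W t ∈ (LinearMap.ker φ).map W.subtype * W ⊔ W * (LinearMap.ker φ).map W.subtype := by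
  have hmem := mem_sup_range_of_map_eq_zero hφ ht
  obtain ⟨_, ⟨u, rfl⟩, _, ⟨v, rfl⟩, rfl⟩ := Submodule.mem_sup.1 hmem
  clear ht hmem
  rw [map_add, add_comm]
  refine Submodule.add_mem_sup ?_ ?_
  · induction v with
    | zero => simp
    | add x y hx hy => simpa only [map_add] using add_mem hx hy
    | tmul x y =>
      exact Submodule.mul_mem_mul (Submodule.mem_map_of_mem x.2) y.2
  · induction u with
    | zero => simp
    | add x y hx hy => simpa only [map_add] using add_mem hx hy
    | tmul x y =>
      exact Submodule.mul_mem_mul x.2 (Submodule.mem_map_of_mem y.2)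

theorem finite_Mon (k : ℕ) : (Mon K k).Finite := by
  refine ((List.finite_length_eq (Fin 2) k).image
    fun w => (w.map (FreeAlgebra.ι K)).prod).subset ?_
  rintro _ ⟨w, hw, rfl⟩
  exact ⟨w, hw, rfl⟩

instance (k : ℕ) : FiniteDimensional K (Adeg K k) :=
  FiniteDimensional.span_of_finite K (finite_Mon K k)

theorem Adeg_add_le_mul (k l : ℕ) : Adeg K (k + l) ≤ Adeg K k * Adeg K l := by
  rw [Adeg, Submodule.span_le]
  rintro _ ⟨w, hw, rfl⟩
  rw [← List.take_append_drop k w, List.map_append, List.prod_append]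
  exact Submodule.mul_mem_mul
    (Submodule.subset_span ⟨w.take k, by simp [hw], rfl⟩)
    (Submodule.subset_span ⟨w.drop k, by simp [hw], rfl⟩)

/-- **Lemma 6.2** (Lemma 3.3 of [sb]).  Over an algebraically closed field, given
`T ⊆ A(2^n)` and `Q ⊆ A(2^{n+1})` with `dim T + 4 dim Q ≤ dim A(2^n) − 2`, there is a
subspace `F ⊆ A(2^n)` of dimension at most `dim A(2^n) − 2` with `T ⊆ F` and
`Q ⊆ F·A(2^n) + A(2^n)·F`. -/
theorem statement18 [IsAlgClosed K] (n : ℕ) (T Q : Submodule K (FA K))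
    (hT : T ≤ Adeg K (2 ^ n)) (hQ : Q ≤ Adeg K (2 ^ (n + 1)))
    (hdim : Module.finrank K T + 4 * Module.finrank K Q ≤
      Module.finrank K (Adeg K (2 ^ n)) - 2) :
    ∃ F : Submodule K (FA K), F ≤ Adeg K (2 ^ n) ∧
      Module.finrank K F ≤ Module.finrank K (Adeg K (2 ^ n)) - 2 ∧
      T ≤ F ∧ Q ≤ F * Adeg K (2 ^ n) ⊔ Adeg K (2 ^ n) * F := by
  have : FiniteDimensional K T := Submodule.finiteDimensional_of_le hT
  have : FiniteDimensional K Q := Submodule.finiteDimensional_of_le hQ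
  by_cases hW : Module.finrank K (Adeg K (2 ^ n)) < 2
  · have hT0 : T = ⊥ := Submodule.finrank_eq_zero.1 (by omega)
    have hQ0 : Q = ⊥ := Submodule.finrank_eq_zero.1 (by omega)
    exact ⟨⊥, bot_le, by simp, hT0.le, by simp [hQ0]⟩
  set W := Adeg K (2 ^ n) with hWdef
  have hQW : Q ≤ LinearMap.range (W.mulMap W) := by
    rw [Submodule.mulMap_range]
    refine hQ.trans ?_
    rw [pow_succ, mul_two]
    exact Adeg_add_le_mul K _ _
  let e := Module.finBasis K Q
  choose t ht using fun i => hQW (e i).2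
  have hT' : Module.finrank K (T.comap W.subtype) = Module.finrank K T :=
    (Submodule.comapSubtypeEquivOfLe hT).finrank_eq
  obtain ⟨φ, hφ, hTφ, htφ⟩ := exists_surjective_pi_two (T.comap W.subtype) t (by
    rw [hT', Nat.card_eq_fintype_card, Fintype.card_fin]; omega)
  have hrank := φ.finrank_range_add_finrank_ker
  rw [LinearMap.range_eq_top.2 hφ, finrank_top, Module.finrank_fin_fun] at hrank
  refine ⟨(LinearMap.ker φ).map W.subtype, Submodule.map_subtype_le _ _, ?_, ?_, ?_⟩
  · rw [Submodule.finrank_map_subtype_eq]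
    omega
  · intro x hx
    exact ⟨⟨x, hT hx⟩, hTφ hx, rfl⟩
  · intro x hx
    have hspan := congrArg (Submodule.map Q.subtype) e.span_eq
    rw [Submodule.map_subtype_top, Submodule.map_span] at hspan
    refine (hspan ▸ Submodule.span_le.2 ?_ : Q ≤ _) hx
    rintro _ ⟨_, ⟨i, rfl⟩, rfl⟩
    rw [Submodule.subtype_apply, ← ht i]
    exact map_mulMap_ker_le W hφ (htφ i)

end
end
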